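/- arXiv:1507.06497 — 7 statements merged into one kernel-verified Lean document; each statement's English description precedes it below -/
import Mathlib

section
/- Let A, G, w be real numbers with G > 0 and set γ := √(G/2). Define u : ℝ → ℝ by u(t) = 1 + (w/γ)·sinh(γt) − ((A − 2w² − G)/(4γ²))·(cosh(γt) − 1). Then u(0) = 1, u'(0) = w, and for every t ∈ ℝ with u(t) ≠ 0 one has 4u''(t) + (A − 2u'(t)²)/u(t) − G·u(t) = 0. -/
/-- the closed hyperbolic-form solution of the scalar geodesic
volume equation `4u'' + (A − 2u'²)/u − G·u = 0` with `u(0) = 1`, `u'(0) = w`. -/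
theorem stmt_0 (A G w : ℝ) (hG : 0 < G) (γ : ℝ) (hγ : γ = Real.sqrt (G / 2))
    (u : ℝ → ℝ)
    (hu : ∀ t : ℝ, u t = 1 + (w / γ) * Real.sinh (γ * t)
      - ((A - 2 * w ^ 2 - G) / (4 * γ ^ 2)) * (Real.cosh (γ * t) - 1)) :
    u 0 = 1 ∧ deriv u 0 = w ∧
      ∀ t : ℝ, u t ≠ 0 →
        4 * deriv (deriv u) t + (A - 2 * (deriv u t) ^ 2) / u t - G * u t = 0 := by
  have hγ0 : 0 < γ := by rw [hγ]; exact Real.sqrt_pos.mpr (by linarith)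
  have hγ2 : γ ^ 2 = G / 2 := by rw [hγ]; exact Real.sq_sqrt (by linarith)
  have hGe : G = 2 * γ ^ 2 := by linarith
  obtain ⟨k, hk⟩ : ∃ k, k = (A - 2 * w ^ 2 - G) / (4 * γ ^ 2) := ⟨_, rfl⟩
  obtain ⟨b, hb⟩ : ∃ b, b = w / γ := ⟨_, rfl⟩
  rw [← hk, ← hb] at hu
  have hw : w = b * γ := by rw [hb]; field_simp
  have hA : A = 4 * γ ^ 2 * k + 2 * w ^ 2 + G := by rw [hk]; field_simp; ring
  have hlin : ∀ t : ℝ, HasDerivAt (fun s : ℝ => γ * s) γ t := fun t => by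
    simpa using (hasDerivAt_id t).const_mul γ
  have hS : ∀ t : ℝ, HasDerivAt (fun s : ℝ => Real.sinh (γ * s)) (Real.cosh (γ * t) * γ) t :=
    fun t => (hlin t).sinh
  have hC : ∀ t : ℝ, HasDerivAt (fun s : ℝ => Real.cosh (γ * s)) (Real.sinh (γ * t) * γ) t :=
    fun t => (hlin t).cosh
  have hu' : u = fun t => 1 + b * Real.sinh (γ * t) - k * (Real.cosh (γ * t) - 1) := funext hu
  have hd : deriv u = fun t =>
      b * (Real.cosh (γ * t) * γ) - k * (Real.sinh (γ * t) * γ) := by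
    funext t
    rw [hu']
    exact ((((hS t).const_mul b).const_add 1).sub (((hC t).sub_const 1).const_mul k)).deriv
  have hdd : ∀ t, deriv (deriv u) t =
      b * (Real.sinh (γ * t) * γ * γ) - k * (Real.cosh (γ * t) * γ * γ) := by
    intro t
    rw [hd]
    exact ((((hC t).mul_const γ).const_mul b).sub (((hS t).mul_const γ).const_mul k)).deriv
  refine ⟨by simp [hu], by simp [hd, hw], fun t ht => ?_⟩
  have hcs := Real.cosh_sq (γ * t)
  have key : 4 * deriv (deriv u) t * u t + (A - 2 * (deriv u t) ^ 2) - G * u t * u t = 0 := by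
    rw [hdd, hd, hu, hA, hw, hGe]
    linear_combination (2 * γ ^ 2 * k ^ 2 - 2 * γ ^ 2 * b ^ 2) * hcs
  have : 4 * deriv (deriv u) t + (A - 2 * (deriv u t) ^ 2) / u t - G * u t =
      (4 * deriv (deriv u) t * u t + (A - 2 * (deriv u t) ^ 2) - G * u t * u t) / u t := by
    field_simp
  rw [this, key, zero_div]
end

section
/- Let A, G, w be real numbers. Define u : ℝ → ℝ by u(t) = 1 + w·∑_{k≥0} (G/2)^k · t^{2k+1}/(2k+1)! − ((A − 2w² − G)/4)·∑_{k≥1} (G/2)^{k−1} · t^{2k}/(2k)!. Then both series converge absolutely for every t ∈ ℝ, u is infinitely differentiable, u(0) = 1, u'(0) = w, and for every t with u(t) ≠ 0 one has 4u''(t) + (A − 2u'(t)²)/u(t) − G·u(t) = 0. -/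
theorem aux_summable_even (c t : ℝ) :
    Summable (fun k : ℕ => |c| ^ k * |t| ^ (2 * k) / (Nat.factorial (2 * k) : ℝ)) := by
  have h := (Real.summable_pow_div_factorial (√|c| * |t|)).comp_injective
    (i := fun k : ℕ => 2 * k) (fun a b h => by simpa using h)
  refine h.congr fun k => ?_
  simp only [Function.comp]
  rw [mul_pow, pow_mul (√|c|), Real.sq_sqrt (abs_nonneg c)]

theorem aux_summable_shift (c t : ℝ) (j : ℕ) :
    Summable (fun k : ℕ => |c| ^ k * |t| ^ (2 * k + j) / (Nat.factorial (2 * k + j) : ℝ)) := by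
  refine Summable.of_nonneg_of_le (fun k => by positivity) (fun k => ?_)
    ((aux_summable_even c t).mul_left (|t| ^ j))
  have h : (Nat.factorial (2 * k) : ℝ) ≤ Nat.factorial (2 * k + j) := by
    exact_mod_cast Nat.factorial_le (by omega)
  have h0 : (0 : ℝ) < Nat.factorial (2 * k) := by positivity
  calc |c| ^ k * |t| ^ (2 * k + j) / (Nat.factorial (2 * k + j) : ℝ)
      ≤ |c| ^ k * |t| ^ (2 * k + j) / (Nat.factorial (2 * k) : ℝ) := by gcongr
    _ = _ := by rw [pow_add]; ring

theorem aux_abs (c t : ℝ) (j : ℕ) :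
    Summable (fun k : ℕ => |c ^ k * t ^ (2 * k + j) / (Nat.factorial (2 * k + j) : ℝ)|) := by
  refine (aux_summable_shift c t j).congr fun k => ?_
  rw [abs_div, abs_mul, abs_pow, abs_pow, Nat.abs_cast]

theorem aux_deriv (c t : ℝ) (j : ℕ) :
    HasDerivAt (fun t : ℝ => ∑' k : ℕ, c ^ k * t ^ (2 * k + (j + 1))
        / (Nat.factorial (2 * k + (j + 1)) : ℝ))
      (∑' k : ℕ, c ^ k * t ^ (2 * k + j) / (Nat.factorial (2 * k + j) : ℝ)) t := by
  refine hasDerivAt_tsum_of_isPreconnected (t := Metric.ball 0 (|t| + 1)) (y₀ := t)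
    (g := fun (k : ℕ) (t : ℝ) => c ^ k * t ^ (2 * k + (j + 1))
        / (Nat.factorial (2 * k + (j + 1)) : ℝ))
    (g' := fun (k : ℕ) (t : ℝ) => c ^ k * t ^ (2 * k + j) / (Nat.factorial (2 * k + j) : ℝ))
    (aux_summable_shift c (|t| + 1) j) Metric.isOpen_ball
    (convex_ball _ _).isPreconnected ?_ ?_ (by simp) (aux_abs c t (j + 1)).of_abs (by simp)
  · intro k y _
    have h := ((hasDerivAt_pow (2 * k + j + 1) y).const_mul (c ^ k)).div_const
      (Nat.factorial (2 * k + j + 1) : ℝ)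
    refine h.congr_deriv ?_
    rw [Nat.factorial_succ]
    have h0 : (Nat.factorial (2 * k + j) : ℝ) ≠ 0 := by positivity
    have h1 : ((2 * k + j + 1 : ℕ) : ℝ) ≠ 0 := by positivity
    rw [Nat.cast_mul, Nat.add_sub_cancel]
    field_simp
  · intro k y hy
    have hy' : |y| ≤ |(|t| + 1)| := by
      rw [abs_of_nonneg (by positivity : 0 ≤ |t| + 1)]
      simpa using (le_of_lt (by simpa using hy : |y| < |t| + 1))
    rw [Real.norm_eq_abs, abs_div, abs_mul, abs_pow, abs_pow, Nat.abs_cast]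
    gcongr

/-- the power-series solution of the scalar geodesic volume equation
`4u'' + (A − 2u'²)/u − G·u = 0`.  The second series `∑_{k≥1} (G/2)^{k−1} t^{2k}/(2k)!`
is written with the index shifted, as `∑_{k≥0} (G/2)^k t^{2(k+1)}/(2(k+1))!`. -/
theorem stmt_1 (A G w : ℝ) (u : ℝ → ℝ)
    (hu : ∀ t : ℝ, u t =
      1 + w * ∑' k : ℕ, (G / 2) ^ k * t ^ (2 * k + 1) / (Nat.factorial (2 * k + 1))
        - ((A - 2 * w ^ 2 - G) / 4) *
            ∑' k : ℕ, (G / 2) ^ k * t ^ (2 * (k + 1)) / (Nat.factorial (2 * (k + 1)))) :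
    (∀ t : ℝ, Summable
      (fun k : ℕ => |(G / 2) ^ k * t ^ (2 * k + 1) / (Nat.factorial (2 * k + 1))|)) ∧
    (∀ t : ℝ, Summable
      (fun k : ℕ => |(G / 2) ^ k * t ^ (2 * (k + 1)) / (Nat.factorial (2 * (k + 1)))|)) ∧
    ContDiff ℝ (⊤ : ℕ∞) u ∧ u 0 = 1 ∧ deriv u 0 = w ∧
    ∀ t : ℝ, u t ≠ 0 →
      4 * deriv (deriv u) t + (A - 2 * (deriv u t) ^ 2) / u t - G * u t = 0 := by
  obtain ⟨c, hc⟩ : ∃ c, c = G / 2 := ⟨_, rfl⟩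
  have hG : G = 2 * c := by rw [hc]; ring
  rw [← hc] at hu ⊢
  obtain ⟨S, hS⟩ : ∃ S : ℝ → ℝ, S = fun t => ∑' k : ℕ, c ^ k * t ^ (2 * k + 1)
    / (Nat.factorial (2 * k + 1) : ℝ) := ⟨_, rfl⟩
  obtain ⟨C, hC⟩ : ∃ C : ℝ → ℝ, C = fun t => ∑' k : ℕ, c ^ k * t ^ (2 * (k + 1))
    / (Nat.factorial (2 * (k + 1)) : ℝ) := ⟨_, rfl⟩
  have hu' : ∀ t, u t = 1 + w * S t - ((A - 2 * w ^ 2 - G) / 4) * C t := by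
    intro t; rw [hu t, hS, hC]
  have dC : ∀ t, HasDerivAt C (S t) t := by
    intro t; rw [hC, hS]; exact aux_deriv c t 1
  have dS : ∀ t, HasDerivAt S (1 + c * C t) t := by
    intro t
    have h := aux_deriv c t 0
    rw [(aux_abs c t 0).of_abs.tsum_eq_zero_add] at h
    rw [hS, hC]
    convert h using 1
    simp only [← tsum_mul_left]
    congr 1
    · simp
    · refine tsum_congr fun k => ?_
      rw [add_zero, pow_succ]; ring
  have S0 : S 0 = 0 := by rw [hS]; simp
  have C0 : C 0 = 0 := by rw [hC]; simp
  have deS : deriv S = fun t => 1 + c * C t := funext fun t => (dS t).deriv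
  have deC : deriv C = S := funext fun t => (dC t).deriv
  have hid : ∀ t, S t ^ 2 - 2 * C t - c * C t ^ 2 = 0 := by
    have hd : ∀ t, HasDerivAt (fun t => S t ^ 2 - 2 * C t - c * C t ^ 2) 0 t := by
      intro t
      have h := (((dS t).pow 2).sub ((dC t).const_mul 2)).sub (((dC t).pow 2).const_mul c)
      refine h.congr_deriv ?_
      simp; ring
    intro t
    have h := is_const_of_deriv_eq_zero (fun t => (hd t).differentiableAt)
      (fun t => (hd t).deriv) t 0
    simpa [S0, C0] using h
  have smooth : ∀ n : ℕ, ContDiff ℝ n S ∧ ContDiff ℝ n C := by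
    intro n
    induction n with
    | zero =>
      simp only [Nat.cast_zero, contDiff_zero]
      exact ⟨continuous_iff_continuousAt.2 fun t => (dS t).continuousAt,
        continuous_iff_continuousAt.2 fun t => (dC t).continuousAt⟩
    | succ n ih =>
      push_cast
      rw [contDiff_succ_iff_deriv, contDiff_succ_iff_deriv, deS, deC]
      exact ⟨⟨fun t => (dS t).differentiableAt, by simp,
        contDiff_const.add (contDiff_const.mul ih.2)⟩,
        ⟨fun t => (dC t).differentiableAt, by simp, ih.1⟩⟩
  have du : ∀ t, HasDerivAt u (w * (1 + c * C t) - ((A - 2 * w ^ 2 - G) / 4) * S t) t := by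
    intro t
    rw [funext hu']
    exact (((dS t).const_mul w).const_add 1).sub ((dC t).const_mul _)
  have deu : deriv u = fun t => w * (1 + c * C t) - ((A - 2 * w ^ 2 - G) / 4) * S t :=
    funext fun t => (du t).deriv
  have ddu : ∀ t, deriv (deriv u) t =
      w * (c * S t) - ((A - 2 * w ^ 2 - G) / 4) * (1 + c * C t) := by
    intro t
    rw [deu]
    exact (((((dC t).const_mul c).const_add 1).const_mul w).sub ((dS t).const_mul _)).deriv
  refine ⟨fun t => aux_abs c t 1, fun t => aux_abs c t 2, ?_, ?_, ?_, ?_⟩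
  · rw [funext hu']
    have h1 : ContDiff ℝ (⊤ : ℕ∞) S := contDiff_infty.2 fun n => (smooth n).1
    have h2 : ContDiff ℝ (⊤ : ℕ∞) C := contDiff_infty.2 fun n => (smooth n).2
    exact (contDiff_const.add (contDiff_const.mul h1)).sub (contDiff_const.mul h2)
  · rw [hu', S0, C0]; ring
  · rw [deu]; simp [S0, C0]
  · intro t ht
    have key : 4 * deriv (deriv u) t * u t + (A - 2 * (deriv u t) ^ 2) - G * u t * u t = 0 := by
      rw [ddu, deu, hu']
      simp only
      obtain ⟨B, hB⟩ : ∃ B, B = (A - 2 * w ^ 2 - G) / 4 := ⟨_, rfl⟩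
      have hA : A = 4 * B + 2 * w ^ 2 + 2 * c := by rw [hB, hG]; ring
      rw [← hB, hG, hA]
      linear_combination (2 * c * w ^ 2 - 2 * B ^ 2) * hid t
    field_simp
    linear_combination key
end

section
/- Let n ∈ ℕ, let φ : ℝ → ℝ be continuous, and let A, J : ℝ → M_n(ℝ) be differentiable with A continuous, satisfying J'(t) = J(t)·A(t) and A'(t) = −φ(t)·A(t) for all t ∈ ℝ. If J(0)·A(0) + A(0)·J(0) = 0, then J(t)·A(t) + A(t)·J(t) = 0 for all t ∈ ℝ. -/
attribute [local instance] Matrix.linftyOpNormedRing Matrix.linftyOpNormedAlgebra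

/-- if `J' = J·A`, `A' = −φ·A` with `φ` and `A` continuous, and `J(0)`
anticommutes with `A(0)`, then `J(t)` anticommutes with `A(t)` for all `t`. -/
theorem stmt_8 (n : ℕ) (φ : ℝ → ℝ) (hφ : Continuous φ)
    (A J : ℝ → Matrix (Fin n) (Fin n) ℝ)
    (hA : Differentiable ℝ A) (hAc : Continuous A) (hJ : Differentiable ℝ J)
    (hJ' : ∀ t : ℝ, deriv J t = J t * A t)
    (hA' : ∀ t : ℝ, deriv A t = -(φ t) • A t)
    (h0 : J 0 * A 0 + A 0 * J 0 = 0) :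
    ∀ t : ℝ, J t * A t + A t * J t = 0 := by
  intro t
  have hd : ∀ s, HasDerivAt (fun s => J s * A s + A s * J s)
      ((J s * A s + A s * J s) * A s - φ s • (J s * A s + A s * J s)) s := by
    intro s
    have h1 : HasDerivAt J (J s * A s) s := hJ' s ▸ (hJ s).hasDerivAt
    have h2 : HasDerivAt A (-(φ s) • A s) s := hA' s ▸ (hA s).hasDerivAt
    have h3 := (h1.mul h2).add (h2.mul h1)
    refine h3.congr_deriv ?_
    simp only [add_mul, smul_add, neg_smul, mul_neg, neg_mul, mul_smul_comm, smul_mul_assoc,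
      mul_assoc]
    abel
  obtain ⟨K, hK⟩ := (isCompact_Icc (a := -(|t| + 1)) (b := |t| + 1)).bddAbove_image
    (f := fun s => ‖A s‖ + ‖φ s‖) (hAc.norm.add hφ.norm).continuousOn
  have hK' : ∀ s ∈ Set.Ioo (-(|t| + 1)) (|t| + 1), ‖A s‖ + ‖φ s‖ ≤ K := fun s hs =>
    hK ⟨s, Set.Ioo_subset_Icc_self hs, rfl⟩
  have key := ODE_solution_unique_of_mem_Ioo (t₀ := 0) (a := -(|t| + 1)) (b := |t| + 1)
    (K := K.toNNReal) (s := fun _ => Set.univ)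
    (v := fun s x => x * A s - φ s • x)
    (f := fun s => J s * A s + A s * J s) (g := fun _ => 0)
    (fun s hs => by
      refine LipschitzOnWith.of_dist_le_mul fun x _ y _ => ?_
      rw [dist_eq_norm, dist_eq_norm]
      have e : x * A s - φ s • x - (y * A s - φ s • y) = (x - y) * A s - φ s • (x - y) := by
        rw [sub_mul, smul_sub]; abel
      rw [e]
      calc _ ≤ ‖(x - y) * A s‖ + ‖φ s • (x - y)‖ := norm_sub_le _ _
        _ ≤ ‖x - y‖ * ‖A s‖ + ‖φ s‖ * ‖x - y‖ :=
          add_le_add (norm_mul_le _ _) (norm_smul_le _ _)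
        _ = (‖A s‖ + ‖φ s‖) * ‖x - y‖ := by ring
        _ ≤ _ := mul_le_mul_of_nonneg_right ((hK' s hs).trans (Real.le_coe_toNNReal K))
          (norm_nonneg _))
    (by constructor <;> linarith [abs_nonneg t])
    (fun s _ => ⟨hd s, trivial⟩)
    (fun s _ => ⟨by simpa using hasDerivAt_const s (0 : Matrix (Fin n) (Fin n) ℝ), trivial⟩)
    h0
  exact key (by constructor <;> linarith [neg_abs_le t, le_abs_self t])
end

section
/- Let n ∈ ℕ, let B : ℝ → M_n(ℝ) be continuous, and let J : ℝ → M_n(ℝ) be differentiable satisfying 2·J'(t) = J(t)·B(t) − B(t)·J(t) for all t ∈ ℝ. If J(0)² = −𝟙, then J(t)² = −𝟙 for all t ∈ ℝ, where 𝟙 is the identity matrix. -/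
attribute [local instance] Matrix.linftyOpNormedRing Matrix.linftyOpNormedAlgebra

/-- The same fact in an arbitrary real normed algebra. -/
theorem sq_eq_neg_one_of_evolution {A : Type*} [NormedRing A] [NormedAlgebra ℝ A]
    (B J : ℝ → A) (hB : Continuous B) (hJ : Differentiable ℝ J)
    (hode : ∀ t : ℝ, (2 : ℝ) • deriv J t = J t * B t - B t * J t)
    (h0 : J 0 * J 0 = -1) (t : ℝ) : J t * J t = -1 := by
  obtain ⟨C, hC⟩ := (isCompact_Icc (a := -(|t| + 1)) (b := |t| + 1)).exists_bound_of_continuousOn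
    hB.continuousOn
  have hd : ∀ s, deriv J s = (1 / 2 : ℝ) • (J s * B s - B s * J s) := by
    intro s
    rw [← hode s, smul_smul]
    norm_num
  have key := ODE_solution_unique_of_mem_Ioo (a := -(|t| + 1)) (b := |t| + 1) (t₀ := 0)
    (v := fun s X => (1 / 2 : ℝ) • (X * B s - B s * X)) (s := fun _ => Set.univ)
    (K := C.toNNReal) (f := fun s => J s * J s) (g := fun _ => (-1 : A))
    ?_ ?_ ?_ ?_ h0
  · exact key (show t ∈ Set.Ioo _ _ from
      ⟨by linarith [neg_abs_le t], by linarith [le_abs_self t]⟩)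
  · intro s hs
    apply LipschitzWith.lipschitzOnWith
    apply LipschitzWith.of_dist_le_mul
    intro X Y
    have hb : ‖B s‖ ≤ C := hC s (Set.Ioo_subset_Icc_self hs)
    have hC0 : 0 ≤ C := (norm_nonneg _).trans hb
    rw [dist_eq_norm, dist_eq_norm, Real.coe_toNNReal _ hC0, ← smul_sub]
    have e : X * B s - B s * X - (Y * B s - B s * Y) = (X - Y) * B s - B s * (X - Y) := by
      noncomm_ring
    rw [e, norm_smul]
    have h1 := norm_sub_le ((X - Y) * B s) (B s * (X - Y))
    have h2 := norm_mul_le (X - Y) (B s)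
    have h3 := norm_mul_le (B s) (X - Y)
    have h4 := mul_le_mul_of_nonneg_right hb (norm_nonneg (X - Y))
    have h5 : ‖(1 / 2 : ℝ)‖ = 1 / 2 := by norm_num
    rw [h5]
    nlinarith
  · have := abs_nonneg t
    constructor <;> linarith
  · intro s _
    refine ⟨?_, trivial⟩
    have h := (hJ s).hasDerivAt.mul (hJ s).hasDerivAt
    have e : deriv J s * J s + J s * deriv J s =
        (1 / 2 : ℝ) • (J s * J s * B s - B s * (J s * J s)) := by
      rw [hd s, smul_mul_assoc, mul_smul_comm, ← smul_add]
      congr 1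
      noncomm_ring
    rw [e] at h
    exact h
  · intro s _
    refine ⟨?_, trivial⟩
    simpa using hasDerivAt_const s (-1 : A)

/-- the evolution `2J' = JB − BJ` preserves the almost complex
structure condition `J² = −𝟙`. -/
theorem stmt_9 (n : ℕ) (B : ℝ → Matrix (Fin n) (Fin n) ℝ) (hB : Continuous B)
    (J : ℝ → Matrix (Fin n) (Fin n) ℝ) (hJ : Differentiable ℝ J)
    (hode : ∀ t : ℝ, (2 : ℝ) • deriv J t = J t * B t - B t * J t)
    (h0 : J 0 * J 0 = -1) :
    ∀ t : ℝ, J t * J t = -1 := by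
  exact fun t => sq_eq_neg_one_of_evolution B J hB hJ hode h0 t
end

section
/- Let n ∈ ℕ, let ω be an invertible skew-symmetric real n×n matrix, let φ : ℝ → ℝ be continuous, and let g : ℝ → M_n(ℝ) be a twice differentiable path of invertible symmetric matrices satisfying (d/dt)(g(t)⁻¹g'(t)) + φ(t)·g(t)⁻¹g'(t) = 0 for all t ∈ ℝ. Set J(t) := −ω⁻¹·g(t) and A(t) := g(t)⁻¹g'(t). If J(0)² = −𝟙 and A(0)·J(0) = −J(0)·A(0), then for all t ∈ ℝ one has J(t)² = −𝟙 and A(t)·J(t) = −J(t)·A(t). -/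
attribute [local instance] Matrix.linftyOpNormedRing Matrix.linftyOpNormedAlgebra

/-- uniqueness for `X' = u X B` with `X 0 = 0`. -/
theorem aux_zero {R : Type*} [NormedRing R] [NormedAlgebra ℝ R] [CompleteSpace R] (B : R) (u : ℝ → ℝ) (hu : Continuous u)
    (X : ℝ → R)
    (hX : ∀ t, HasDerivAt X (X t * (u t • B)) t) (h0 : X 0 = 0) (t : ℝ) : X t = 0 := by
  have hs : ∀ t, HasDerivAt (fun t => ∫ x in (0 : ℝ)..t, u x) (u t) t := fun t =>
    intervalIntegral.integral_hasDerivAt_right (hu.intervalIntegrable _ _)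
      (hu.stronglyMeasurableAtFilter _ _) hu.continuousAt
  set s : ℝ → ℝ := fun t => ∫ x in (0 : ℝ)..t, u x with hsdef
  have hE : ∀ t, HasDerivAt (fun t => NormedSpace.exp (s t • (-B)))
      (u t • (-B * NormedSpace.exp (s t • (-B)))) t := fun t =>
    HasDerivAt.scomp t (hasDerivAt_exp_smul_const' (𝕂 := ℝ) (-B) (s t)) (hs t)
  have hY : ∀ t, HasDerivAt (fun t => X t * NormedSpace.exp (s t • (-B))) 0 t := fun t => by
    refine HasDerivAt.congr_deriv ((hX t).mul (hE t)) ?_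
    simp [mul_assoc]
  have hc := is_const_of_deriv_eq_zero (fun t => (hY t).differentiableAt)
    (fun t => (hY t).deriv) t 0
  simp only [h0, zero_mul] at hc
  letI : NormedAlgebra ℚ R := NormedAlgebra.restrictScalars ℚ ℝ R
  exact (NormedSpace.isUnit_exp (s t • (-B))).mul_left_eq_zero.mp hc

theorem aux_main {R : Type*} [NormedRing R] [NormedAlgebra ℝ R] [CompleteSpace R] (φ : ℝ → ℝ) (hφ : Continuous φ)
    (J A : ℝ → R) (hA' : ∀ t, HasDerivAt A (-(φ t • A t)) t)
    (hJ' : ∀ t, HasDerivAt J (J t * A t) t)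
    (hJ0 : J 0 * J 0 = -1) (hA0 : A 0 * J 0 = -(J 0 * A 0)) :
    ∀ t : ℝ, J t * J t = -1 ∧ A t * J t = -(J t * A t) := by
  have hP : ∀ t, HasDerivAt (fun t => ∫ x in (0 : ℝ)..t, φ x) (φ t) t := fun t =>
    intervalIntegral.integral_hasDerivAt_right (hφ.intervalIntegrable _ _)
      (hφ.stronglyMeasurableAtFilter _ _) hφ.continuousAt
  obtain ⟨P, hPd, hP0⟩ : ∃ P : ℝ → ℝ, (∀ t, HasDerivAt P (φ t) t) ∧ P 0 = 0 :=
    ⟨_, hP, by simp⟩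
  have hAc : ∀ t, A t = Real.exp (-P t) • A 0 := by
    intro t
    have hY : ∀ t, HasDerivAt (fun t => Real.exp (P t) • A t) 0 t := fun t => by
      refine HasDerivAt.congr_deriv (((hPd t).exp).smul (hA' t)) ?_
      rw [smul_neg, smul_smul]
      simp
    have hc := is_const_of_deriv_eq_zero (fun t => (hY t).differentiableAt)
      (fun t => (hY t).deriv) t 0
    simp only [hP0, Real.exp_zero, one_smul] at hc
    rw [← hc, smul_smul, ← Real.exp_add]
    simp
  have hPc : Continuous P := continuous_iff_continuousAt.mpr fun t => (hPd t).continuousAt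
  have hu : Continuous fun t => Real.exp (-P t) := by fun_prop
  have hK : ∀ t, A 0 * J t + J t * A 0 = 0 := by
    refine aux_zero (A 0) _ hu (fun t => A 0 * J t + J t * A 0) ?_ (by simp [hA0])
    intro t
    refine HasDerivAt.congr_deriv (((hJ' t).const_mul (A 0)).add ((hJ' t).mul_const (A 0))) ?_
    rw [hAc t]
    simp [add_mul, mul_assoc]
  have hAJ : ∀ t, A t * J t = -(J t * A t) := by
    intro t
    rw [hAc t, smul_mul_assoc, mul_smul_comm, eq_neg_of_add_eq_zero_left (hK t), smul_neg]
  intro t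
  refine ⟨?_, hAJ t⟩
  have hY : ∀ t, HasDerivAt (fun t => J t * J t) 0 t := fun t => by
    refine HasDerivAt.congr_deriv ((hJ' t).mul (hJ' t)) ?_
    rw [mul_assoc, hAJ t]
    simp
  have hc := is_const_of_deriv_eq_zero (fun t => (hY t).differentiableAt)
    (fun t => (hY t).deriv) t 0
  exact hc.trans hJ0

/-- pointwise content of the almost complex geodesic lemma: along a
solution of `(d/dt)(g⁻¹g') + φ·(g⁻¹g') = 0` by symmetric invertible matrices, with
`J = −ω⁻¹g` and `A = g⁻¹g'`, the conditions `J² = −𝟙` and `AJ = −JA` propagate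
from `t = 0` to all times. -/
theorem stmt_10 (n : ℕ) (ω : Matrix (Fin n) (Fin n) ℝ)
    (hω : IsUnit ω) (hωskew : ω.transpose = -ω)
    (φ : ℝ → ℝ) (hφ : Continuous φ)
    (g : ℝ → Matrix (Fin n) (Fin n) ℝ)
    (hg : Differentiable ℝ g) (hg' : Differentiable ℝ (deriv g))
    (hgsym : ∀ t : ℝ, (g t).IsSymm) (hginv : ∀ t : ℝ, IsUnit (g t))
    (hode : ∀ t : ℝ, deriv (fun s => (g s)⁻¹ * deriv g s) t
      + φ t • ((g t)⁻¹ * deriv g t) = 0)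
    (J A : ℝ → Matrix (Fin n) (Fin n) ℝ)
    (hJ : ∀ t : ℝ, J t = -(ω⁻¹ * g t)) (hA : ∀ t : ℝ, A t = (g t)⁻¹ * deriv g t)
    (hJ0 : J 0 * J 0 = -1) (hA0 : A 0 * J 0 = -(J 0 * A 0)) :
    ∀ t : ℝ, J t * J t = -1 ∧ A t * J t = -(J t * A t) := by
  have : CompleteSpace (Matrix (Fin n) (Fin n) ℝ) := FiniteDimensional.complete ℝ _
  have hAd : Differentiable ℝ (fun s => (g s)⁻¹ * deriv g s) := by
    intro t
    refine DifferentiableAt.mul ?_ (hg' t)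
    simp only [Matrix.nonsing_inv_eq_ringInverse]
    obtain ⟨v, hv⟩ := hginv t
    have h1 := differentiableAt_inverse (𝕜 := ℝ) (hginv t)
    exact h1.comp t (hg t)
  have hAfun : A = fun s => (g s)⁻¹ * deriv g s := funext hA
  have hA' : ∀ t, HasDerivAt A (-(φ t • A t)) t := by
    intro t
    have h := (hAd t).hasDerivAt
    have e : deriv (fun s => (g s)⁻¹ * deriv g s) t = -(φ t • ((g t)⁻¹ * deriv g t)) :=
      eq_neg_of_add_eq_zero_left (hode t)
    rw [hAfun]
    exact h.congr_deriv e
  have hJ' : ∀ t, HasDerivAt J (J t * A t) t := by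
    intro t
    have h := (((hg t).hasDerivAt).const_mul ω⁻¹).neg
    have hgg : g t * (g t)⁻¹ = 1 :=
      Matrix.mul_nonsing_inv _ ((Matrix.isUnit_iff_isUnit_det _).mp (hginv t))
    have e : J t * A t = -(ω⁻¹ * deriv g t) := by
      rw [hJ, hA, neg_mul, mul_assoc, ← mul_assoc (g t), hgg, one_mul]
    rw [e, funext hJ]
    exact h
  exact aux_main φ hφ J A hA' hJ' hJ0 hA0
end

section
/- Let V be a finite-dimensional real inner product space, let J : V → V be linear with J² = −id and ⟨Jξ, Jη⟩ = ⟨ξ, η⟩ for all ξ, η, let H : V → V be self-adjoint with H∘J = −J∘H, let N : V × V → V be an alternating bilinear map with N(Jξ, η) = −J(N(ξ, η)) for all ξ, η, and let P : V → End(V) be a linear map satisfying ⟨P(ξ)η, μ⟩ = −2⟨Jξ, N(η, μ)⟩ for all ξ, η, μ ∈ V. Then for every orthonormal basis (e_k) of V and every η ∈ V: 2·∑_k ⟨e_k, N(η, H(e_k))⟩ = ∑_k ⟨J(H(P(e_k)η)), e_k⟩. -/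
open RealInnerProductSpace

/-- the trace identity `2·Tr[N(η, H•)] = Tr(J·H·P(•)η)` for a compatible
complex structure `J`, a self-adjoint `H` anticommuting with `J`, an alternating
bilinear `N` with `N(Jξ,η) = −J N(ξ,η)`, and `P` with `⟨P(ξ)η,μ⟩ = −2⟨Jξ,N(η,μ)⟩`. -/
theorem stmt_14 (V : Type*) [NormedAddCommGroup V] [InnerProductSpace ℝ V]
    [FiniteDimensional ℝ V]
    (J : V →ₗ[ℝ] V) (hJ2 : ∀ v : V, J (J v) = -v)
    (hJiso : ∀ ξ η : V, ⟪J ξ, J η⟫ = ⟪ξ, η⟫)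
    (H : V →ₗ[ℝ] V) (hHsa : ∀ ξ η : V, ⟪H ξ, η⟫ = ⟪ξ, H η⟫)
    (hHJ : ∀ v : V, H (J v) = -J (H v))
    (N : V →ₗ[ℝ] V →ₗ[ℝ] V) (hNalt : ∀ ξ η : V, N ξ η = -N η ξ)
    (hNJ : ∀ ξ η : V, N (J ξ) η = -J (N ξ η))
    (P : V →ₗ[ℝ] (V →ₗ[ℝ] V))
    (hP : ∀ ξ η μ : V, ⟪P ξ η, μ⟫ = -2 * ⟪J ξ, N η μ⟫)
    (ι : Type*) [Fintype ι] (b : OrthonormalBasis ι ℝ V) (η : V) :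
    2 * ∑ k, ⟪b k, N η (H (b k))⟫ = ∑ k, ⟪J (H (P (b k) η)), b k⟫ := by
  rw [Finset.mul_sum]
  refine Finset.sum_congr rfl fun k _ => ?_
  have skew : ∀ x y : V, ⟪J x, y⟫ = -⟪x, J y⟫ := fun x y => by
    have h := hJiso (J x) y
    rw [hJ2, inner_neg_left] at h
    linarith
  have hN2 : ∀ μ : V, N η (J μ) = -J (N η μ) := fun μ => by
    rw [hNalt η (J μ), hNJ, hNalt η μ, map_neg]
  rw [skew, hHsa, hHJ, inner_neg_right, hP, hN2, inner_neg_right, hJiso]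
  ring
end

section
/- Let A, G ∈ ℝ, let I ⊆ ℝ be an interval, and let u : I → ℝ be twice differentiable with u(t) ≠ 0 for all t ∈ I and 4u''(t) + (A − 2u'(t)²)/u(t) − G·u(t) = 0 on I. Then the function t ↦ (A − 2u'(t)²)/u(t) + G·u(t) is constant on I. -/
/-- along any solution of `4u'' + (A − 2u'²)/u − G·u = 0` on an
interval, the quantity `(A − 2u'²)/u + G·u` is a first integral (constant). -/
theorem stmt_17 (A G : ℝ) (I : Set ℝ) (hI : Convex ℝ I)
    (u u' u'' : ℝ → ℝ)
    (hu' : ∀ t ∈ I, HasDerivAt u (u' t) t)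
    (hu'' : ∀ t ∈ I, HasDerivAt u' (u'' t) t)
    (hne : ∀ t ∈ I, u t ≠ 0)
    (hode : ∀ t ∈ I, 4 * u'' t + (A - 2 * (u' t) ^ 2) / u t - G * u t = 0) :
    ∀ s ∈ I, ∀ t ∈ I,
      (A - 2 * (u' s) ^ 2) / u s + G * u s = (A - 2 * (u' t) ^ 2) / u t + G * u t := by
  intro s hs t ht
  have key : ∀ x ∈ I, HasDerivWithinAt
      (fun x => (A - 2 * (u' x) ^ 2) / u x + G * u x) 0 I x := by
    intro x hx
    have h1 := (((((hu'' x hx).pow 2).const_mul 2).const_sub A).div (hu' x hx) (hne x hx)).add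
      ((hu' x hx).const_mul G)
    refine HasDerivAt.hasDerivWithinAt (HasDerivAt.congr_deriv h1 ?_)
    have h0 := hne x hx
    have h2 : u'' x = (G * u x - (A - 2 * (u' x) ^ 2) / u x) / 4 := by
      linarith [hode x hx]
    simp only [Pi.pow_apply, h2]
    field_simp
    push_cast
    ring
  have h := hI.norm_image_sub_le_of_norm_hasDerivWithin_le (C := 0) key
    (fun x _ => by simp) ht hs
  rw [zero_mul] at h
  exact sub_eq_zero.mp (norm_le_zero_iff.mp h)
end
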